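/- Let M be an MT-algebra and let K be a compact saturated subset of the atom space at(M). Then the element ⋀{u ∈ O(M) | K ⊆ η(u)} is a compact saturated element of M. -/

import Mathlib

/-- An MT-algebra: a complete Boolean algebra with an interior operator. -/
structure MTAlg (M : Type*) [CompleteBooleanAlgebra M] where
  box : M → M
  box_top : box ⊤ = ⊤
  box_inf : ∀ a b : M, box (a ⊓ b) = box a ⊓ box b
  box_le : ∀ a : M, box a ≤ a
  box_idem : ∀ a : M, box a ≤ box (box a)

namespace MTAlg

variable {M : Type*} [CompleteBooleanAlgebra M] (T : MTAlg M)

/-- The closure (dual) operator. -/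
def dia (a : M) : M := (T.box aᶜ)ᶜ

/-- Open elements. -/
def IsOpenElem (a : M) : Prop := T.box a = a

/-- Closed elements. -/
def IsClosedElem (a : M) : Prop := T.dia a = a

/-- Saturated elements: meets of open elements. -/
def IsSaturatedElem (a : M) : Prop :=
  ∃ S : Set M, (∀ s ∈ S, T.IsOpenElem s) ∧ a = sInf S

/-- Weakly locally closed elements: meets of a saturated and a closed element. -/
def IsWLC (a : M) : Prop :=
  ∃ s c : M, T.IsSaturatedElem s ∧ T.IsClosedElem c ∧ a = s ⊓ c

/-- T0-algebras: every element is a join of weakly locally closed elements. -/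
def IsT0 : Prop :=
  ∀ a : M, ∃ S : Set M, (∀ b ∈ S, T.IsWLC b) ∧ a = sSup S

/-- T1-algebras: every element is a join of closed elements. -/
def IsT1 : Prop :=
  ∀ a : M, ∃ S : Set M, (∀ b ∈ S, T.IsClosedElem b) ∧ a = sSup S

/-- Join-irreducible elements of the lattice of closed elements. -/
def JoinIrredClosed (p : M) : Prop :=
  T.IsClosedElem p ∧ p ≠ ⊥ ∧
    ∀ a b : M, T.IsClosedElem a → T.IsClosedElem b → p = a ⊔ b → p = a ∨ p = b

/-- Sober MT-algebras. -/
def Sober : Prop :=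
  T.IsT0 ∧ ∀ p : M, T.JoinIrredClosed p → ∃ x : M, IsAtom x ∧ p = T.dia x

/-- Filters of the underlying lattice. -/
def IsFilter (F : Set M) : Prop :=
  ⊤ ∈ F ∧ (∀ a b : M, a ∈ F → a ≤ b → b ∈ F) ∧ (∀ a b : M, a ∈ F → b ∈ F → a ⊓ b ∈ F)

/-- Open filters. -/
def IsOpenFilter (F : Set M) : Prop :=
  IsFilter F ∧ ∀ a ∈ F, T.box a ∈ F

/-- Scott-open filters. -/
def IsScottOpenFilter (F : Set M) : Prop :=
  T.IsOpenFilter F ∧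
    ∀ S : Set M, (∀ s ∈ S, T.IsOpenElem s) → S.Nonempty → DirectedOn (· ≤ ·) S →
      sSup S ∈ F → ∃ s ∈ S, s ∈ F

/-- Compact elements. -/
def IsCompactElem (a : M) : Prop :=
  ∀ S : Set M, (∀ s ∈ S, T.IsOpenElem s) → a ≤ sSup S →
    ∃ t ⊆ S, t.Finite ∧ a ≤ sSup t

/-- The relation `a ◁ b`: there is a compact element between `a` and `b`. -/
def Triangle (a b : M) : Prop := ∃ k : M, T.IsCompactElem k ∧ a ≤ k ∧ k ≤ b

/-- Locally compact MT-algebras. -/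
def LocallyCompact : Prop :=
  ∀ u : M, T.IsOpenElem u → u = sSup {v : M | T.IsOpenElem v ∧ T.Triangle v u}

/-- The way-below relation in the frame of open elements. -/
def WayBelowOpen (a b : M) : Prop :=
  ∀ S : Set M, (∀ s ∈ S, T.IsOpenElem s) → b ≤ sSup S →
    ∃ t ⊆ S, t.Finite ∧ a ≤ sSup t

/-- Elements approximated from above by regular closed elements. -/
def GC (a : M) : Prop :=
  a = sInf {b : M | ∃ c : M, a ≤ T.box c ∧ b = T.dia (T.box c)}

/-- Hausdorff MT-algebras. -/
def IsHausdorff : Prop :=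
  ∀ a : M, ∃ S : Set M, (∀ b ∈ S, T.GC b) ∧ a = sSup S

/-- Regular MT-algebras. -/
def IsRegular : Prop :=
  T.IsT1 ∧ ∀ a : M, T.IsOpenElem a →
    a = sSup {b : M | T.IsOpenElem b ∧ T.dia b ≤ a}

end MTAlg

/-- The atom space of a complete Boolean algebra. -/
abbrev AtomSpace (M : Type*) [CompleteBooleanAlgebra M] : Type _ := {x : M // IsAtom x}

/-- The set of atoms below an element. -/
def eta {M : Type*} [CompleteBooleanAlgebra M] (a : M) : Set (AtomSpace M) :=
  {x : AtomSpace M | x.1 ≤ a}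

namespace MTAlg

variable {M : Type*} [CompleteBooleanAlgebra M] (T : MTAlg M)

/-- The topology on the atom space, generated by the images of open elements. -/
def atTop : TopologicalSpace (AtomSpace M) :=
  TopologicalSpace.generateFrom {U : Set (AtomSpace M) | ∃ u : M, T.IsOpenElem u ∧ U = eta u}

end MTAlg

namespace MTAlg

variable {M : Type*} [CompleteBooleanAlgebra M] (T : MTAlg M)

theorem box_mono : Monotone T.box := fun a b h => by
  rw [← inf_eq_left, ← T.box_inf, inf_eq_left.mpr h]

theorem isOpenElem_sSup {S : Set M} (hS : ∀ s ∈ S, T.IsOpenElem s) : T.IsOpenElem (sSup S) :=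
  le_antisymm (T.box_le _) <| sSup_le fun s hs =>
    (hS s hs).symm.le.trans (T.box_mono (le_sSup hs))

theorem isOpen_eta {u : M} (hu : T.IsOpenElem u) : @IsOpen _ T.atTop (eta u) :=
  TopologicalSpace.isOpen_generateFrom_of_mem ⟨u, hu, rfl⟩

end MTAlg

theorem eta_sSup {M : Type*} [CompleteBooleanAlgebra M] (S : Set M) :
    eta (sSup S) = ⋃ s ∈ S, eta s := by
  ext x
  simp only [Set.mem_iUnion, exists_prop]
  refine ⟨fun hx => ?_, fun ⟨s, hs, hxs⟩ => le_trans hxs (le_sSup hs)⟩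
  by_contra! h
  have hdisj : Disjoint x.1 (sSup S) :=
    disjoint_sSup_iff.mpr fun s hs => x.2.not_le_iff_disjoint.mp (h s hs)
  exact x.2.1 (hdisj.eq_bot_of_le hx)

/-- For a compact saturated subset `K` of the atom space, the meet of all open
elements whose `η`-image contains `K` is a compact saturated element of `M`. -/
theorem sInf_opens_over_compactSaturated {M : Type*} [CompleteBooleanAlgebra M]
    (T : MTAlg M) (K : Set (AtomSpace M))
    (hK : @IsCompact (AtomSpace M) T.atTop K)
    (hsat : ∃ U : Set (Set (AtomSpace M)),
      (∀ w ∈ U, @IsOpen (AtomSpace M) T.atTop w) ∧ K = ⋂₀ U) :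
    T.IsCompactElem (sInf {u : M | T.IsOpenElem u ∧ K ⊆ eta u}) ∧
      T.IsSaturatedElem (sInf {u : M | T.IsOpenElem u ∧ K ⊆ eta u}) := by
  refine ⟨fun S hS hle => ?_, _, fun _ hu => hu.1, rfl⟩
  have hcover : K ⊆ ⋃ s ∈ S, eta s := by
    rw [← eta_sSup]
    exact fun x hx => (le_sInf fun u hu => hu.2 hx).trans hle
  let := T.atTop
  obtain ⟨t, htS, hfin, hKt⟩ :=
    hK.elim_finite_subcover_image (fun s hs => T.isOpen_eta (hS s hs)) hcover
  rw [← eta_sSup] at hKt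
  exact ⟨t, htS, hfin, sInf_le ⟨T.isOpenElem_sSup fun s hs => hS s (htS hs), hKt⟩⟩
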